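/- Bregman decomposition of the second-order interaction: for channels i and j and any belief b, ΔVoI(j|i,b) = jensenGap(g, b, i) − jensenGap(h, b, i), where g(b') = ∑_{o_j} P(o_j|b',j) V(b̂'(j,o_j)) is the expected post-j value and h = V is the value function. Moreover both jensenGap(g, b, i) ≥ 0 and jensenGap(h, b, i) ≥ 0. -/

import Mathlib

open Finset

/-- `b` is a probability distribution (belief) on the finite state set `S`. -/
def IsBelief {S : Type*} [Fintype S] (b : S → ℝ) : Prop :=
  (∀ s, 0 ≤ b s) ∧ ∑ s, b s = 1

/-- `P` is a likelihood kernel: for each state `s`, `P · s` is a probability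
distribution on the finite outcome set `O`. -/
def IsKernel {S O : Type*} [Fintype S] [Fintype O] (P : O → S → ℝ) : Prop :=
  (∀ o s, 0 ≤ P o s) ∧ ∀ s, ∑ o, P o s = 1

/-- Marginal outcome probability `P(o | b, k) = ∑ s, P(o | s, k) b(s)`. -/
noncomputable def marginal {S O : Type*} [Fintype S] [Fintype O] (b : S → ℝ) (P : O → S → ℝ) (o : O) : ℝ :=
  ∑ s, P o s * b s

/-- Posterior belief `b̂(k, o)(s) = P(o | s, k) b(s) / P(o | b, k)`. -/
noncomputable def posterior {S O : Type*} [Fintype S] [Fintype O] (b : S → ℝ) (P : O → S → ℝ) (o : O)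
    (s : S) : ℝ :=
  P o s * b s / marginal b P o

/-- Jensen gap of `f` at belief `b` under the channel with kernel `P`:
`∑_{o : P(o|b) > 0} P(o|b) f(b̂(o)) − f(b)`. -/
noncomputable def jensenGap {S O : Type*} [Fintype S] [Fintype O] (f : (S → ℝ) → ℝ) (b : S → ℝ)
    (P : O → S → ℝ) : ℝ :=
  (∑ o ∈ Finset.univ.filter (fun o => 0 < marginal b P o),
      marginal b P o * f (posterior b P o)) - f b

/-- Value function `V(b) = max_{a ∈ A} ∑ s, R(a,s) b(s)`. -/
noncomputable def Val {S A : Type*} [Fintype S] [Fintype A] [Nonempty A] (R : A → S → ℝ) (b : S → ℝ) : ℝ :=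
  Finset.univ.sup' Finset.univ_nonempty (fun a => ∑ s, R a s * b s)

/-- `p` lies in the decision region `ℛ_a`. -/
def InRegion {S A : Type*} [Fintype S] (R : A → S → ℝ) (a : A) (p : S → ℝ) : Prop :=
  ∀ a', ∑ s, R a' s * p s ≤ ∑ s, R a s * p s

/-- Value of information of the channel with kernel `P` at belief `b`. -/
noncomputable def VoI {S A O : Type*} [Fintype S] [Fintype A] [Nonempty A] [Fintype O]
    (R : A → S → ℝ) (P : O → S → ℝ) (b : S → ℝ) : ℝ :=
  jensenGap (Val R) b P

/-- Second-order interaction `ΔVoI(j | i, b)`. -/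
noncomputable def deltaVoI {S A Oi Oj : Type*} [Fintype S] [Fintype A] [Nonempty A] [Fintype Oi] [Fintype Oj]
    (R : A → S → ℝ) (Pi : Oi → S → ℝ) (Pj : Oj → S → ℝ) (b : S → ℝ) : ℝ :=
  (∑ oi ∈ Finset.univ.filter (fun oi => 0 < marginal b Pi oi),
      marginal b Pi oi * VoI R Pj (posterior b Pi oi)) - VoI R Pj b

/-- Expected post-channel-`j` value `g(b) = ∑_{o_j : P(o_j|b,j)>0} P(o_j|b,j) V(b̂(j,o_j))`. -/
noncomputable def expectedPostValue {S A Oj : Type*} [Fintype S] [Fintype A] [Nonempty A]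
    [Fintype Oj] (R : A → S → ℝ) (Pj : Oj → S → ℝ) (b : S → ℝ) : ℝ :=
  ∑ oj ∈ Finset.univ.filter (fun oj => 0 < marginal b Pj oj),
    marginal b Pj oj * Val R (posterior b Pj oj)

theorem Val_smul {S A : Type*} [Fintype S] [Fintype A] [Nonempty A] (R : A → S → ℝ)
    {c : ℝ} (hc : 0 ≤ c) (v : S → ℝ) : Val R (c • v) = c * Val R v := by
  unfold Val
  rw [Finset.mul₀_sup' hc]
  congr 1
  ext a
  rw [Finset.mul_sum]
  refine Finset.sum_congr rfl fun s _ => ?_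
  simp only [Pi.smul_apply, smul_eq_mul]
  ring

theorem Val_add_le {S A : Type*} [Fintype S] [Fintype A] [Nonempty A] (R : A → S → ℝ)
    (v w : S → ℝ) : Val R (v + w) ≤ Val R v + Val R w := by
  refine Finset.sup'_le _ _ fun a ha => ?_
  simp only [Pi.add_apply, mul_add, Finset.sum_add_distrib]
  exact add_le_add (Finset.le_sup' (fun a => ∑ s, R a s * v s) ha)
    (Finset.le_sup' (fun a => ∑ s, R a s * w s) ha)

theorem posterior_nonneg {S O : Type*} [Fintype S] [Fintype O] {b : S → ℝ} {P : O → S → ℝ}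
    (hb : 0 ≤ b) (hP : ∀ o s, 0 ≤ P o s) (o : O) : 0 ≤ posterior b P o := fun s =>
  div_nonneg (mul_nonneg (hP o s) (hb s))
    (Finset.sum_nonneg fun t _ => mul_nonneg (hP o t) (hb t))

/-- For positively homogeneous `f`, the expectation of `f` over posteriors is the sum of `f`
over the unnormalized posteriors. -/
theorem sum_marginal_mul_posterior {S O : Type*} [Fintype S] [Fintype O] {f : (S → ℝ) → ℝ}
    (hf : ∀ c : ℝ, 0 ≤ c → ∀ v, f (c • v) = c * f v) {b : S → ℝ} {P : O → S → ℝ}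
    (hb : 0 ≤ b) (hP : ∀ o s, 0 ≤ P o s) :
    ∑ o ∈ Finset.univ.filter (fun o => 0 < marginal b P o),
      marginal b P o * f (posterior b P o) = ∑ o, f (P o * b) := by
  have hnonneg (o : O) (s : S) : 0 ≤ P o s * b s := mul_nonneg (hP o s) (hb s)
  rw [Finset.sum_filter]
  refine Finset.sum_congr rfl fun o _ => ?_
  split_ifs with h
  · rw [← hf _ h.le]
    congr 1
    ext s
    simp only [Pi.smul_apply, smul_eq_mul, posterior, Pi.mul_apply]
    field_simp
  · have hz : marginal b P o = 0 :=
      le_antisymm (not_lt.mp h) (Finset.sum_nonneg fun s _ => hnonneg o s)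
    have hPb : P o * b = 0 := by
      ext s
      exact (Finset.sum_eq_zero_iff_of_nonneg fun s _ => hnonneg o s).mp hz s (Finset.mem_univ s)
    simpa [hPb] using (hf 0 le_rfl 0).symm

/-- Sublinear functions have nonnegative Jensen gap. -/
theorem jensenGap_nonneg {S O : Type*} [Fintype S] [Fintype O] {f : (S → ℝ) → ℝ}
    (hf : ∀ c : ℝ, 0 ≤ c → ∀ v, f (c • v) = c * f v) (hadd : ∀ v w, f (v + w) ≤ f v + f w)
    {b : S → ℝ} {P : O → S → ℝ} (hb : 0 ≤ b) (hP : IsKernel P) : 0 ≤ jensenGap f b P := by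
  have hsum : ∑ o, P o * b = b := by
    rw [← Finset.sum_mul]
    ext s
    simp [hP.2 s]
  have hzero : f 0 = 0 := by simpa using hf 0 le_rfl 0
  rw [jensenGap, sum_marginal_mul_posterior hf hb hP.1, sub_nonneg]
  simpa only [hsum] using Finset.le_sum_of_subadditive f hzero.le hadd Finset.univ fun o => P o * b

theorem jensenGap_congr {S O : Type*} [Fintype S] [Fintype O] {f g : (S → ℝ) → ℝ}
    (h : ∀ v, 0 ≤ v → f v = g v) {b : S → ℝ} {P : O → S → ℝ} (hb : 0 ≤ b)
    (hP : ∀ o s, 0 ≤ P o s) : jensenGap f b P = jensenGap g b P := by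
  simp only [jensenGap, h b hb, h _ (posterior_nonneg hb hP _)]

theorem jensenGap_expectedPostValue_nonneg {S A Oi Oj : Type*} [Fintype S] [Fintype A]
    [Nonempty A] [Fintype Oi] [Fintype Oj] (R : A → S → ℝ) {Pi : Oi → S → ℝ}
    {Pj : Oj → S → ℝ} {b : S → ℝ} (hb : 0 ≤ b) (hPi : IsKernel Pi) (hPj : IsKernel Pj) :
    0 ≤ jensenGap (expectedPostValue R Pj) b Pi := by
  rw [jensenGap_congr (f := expectedPostValue R Pj) (g := fun v => ∑ o, Val R (Pj o * v)) (fun v hv =>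
    sum_marginal_mul_posterior (fun _ hc => Val_smul R hc) hv hPj.1) hb hPi.1]
  refine jensenGap_nonneg (fun c hc v => ?_) (fun v w => ?_) hb hPi
  · simp only [mul_smul_comm, Val_smul R hc, Finset.mul_sum]
  · rw [← Finset.sum_add_distrib]
    refine Finset.sum_le_sum fun o _ => ?_
    rw [mul_add]
    exact Val_add_le R _ _

/-- **Bregman decomposition**: `ΔVoI(j|i,b) = jensenGap(g,b,i) − jensenGap(h,b,i)`,
where `g` is the expected post-`j` value and `h = V`, and both gaps are non-negative. -/
theorem bregman_decomposition {S A Oi Oj : Type*} [Fintype S] [Nonempty S]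
    [Fintype A] [Nonempty A] [Fintype Oi] [Fintype Oj]
    (R : A → S → ℝ) (Pi : Oi → S → ℝ) (Pj : Oj → S → ℝ) (b : S → ℝ)
    (hb : IsBelief b) (hPi : IsKernel Pi) (hPj : IsKernel Pj) :
    deltaVoI R Pi Pj b =
        jensenGap (expectedPostValue R Pj) b Pi - jensenGap (Val R) b Pi ∧
      0 ≤ jensenGap (expectedPostValue R Pj) b Pi ∧
      0 ≤ jensenGap (Val R) b Pi := by
  refine ⟨?_, jensenGap_expectedPostValue_nonneg R hb.1 hPi hPj,
    jensenGap_nonneg (fun _ hc => Val_smul R hc) (Val_add_le R) hb.1 hPi⟩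
  simp only [deltaVoI, VoI, jensenGap, expectedPostValue, mul_sub, Finset.sum_sub_distrib]
  ring
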